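/- arXiv:0808.2968 — 2 statements merged into one kernel-verified Lean document; each statement's English description precedes it below -/
import Mathlib

section
/- Let U ⊆ ℂ be open, let f : ℂ → ℂ be injective on U and such that either f is holomorphic on U or z ↦ conj(f(z)) is holomorphic on U, and let u : ℂ → ℝ be continuously differentiable on an open set containing f(U). Then the Dirichlet integrals agree: ∫_{f(U)} ‖∇u(w)‖² dw = ∫_U ‖∇(u ∘ f)(z)‖² dz, where dz, dw denote Lebesgue (area) measure on ℂ ≅ ℝ² and the equality holds in [0, ∞] (both sides may be infinite). -/
open MeasureTheory Set

/-- Multiplication by a complex number is a real multiple of a linear isometry. -/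
lemma exists_smul_linearIsometryEquiv_eq_mul (a : ℂ) :
    ∃ (r : ℝ) (e : ℂ ≃ₗᵢ[ℝ] ℂ), ∀ z, a * z = r • e z := by
  refine ⟨‖a‖, rotation (Circle.exp a.arg), fun z => ?_⟩
  rw [rotation_apply, Circle.coe_exp, Complex.real_smul, ← mul_assoc,
    Complex.norm_mul_exp_arg_mul_I]

/-- At a point of complex differentiability, the real derivative is a real multiple of a linear
isometry. -/
lemma DifferentiableAt.exists_hasFDerivAt_smul_linearIsometryEquiv {f : ℂ → ℂ} {z : ℂ}
    (h : DifferentiableAt ℂ f z) :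
    ∃ (r : ℝ) (e : ℂ ≃ₗᵢ[ℝ] ℂ), HasFDerivAt f (r • (e : ℂ →L[ℝ] ℂ)) z := by
  obtain ⟨r, e, he⟩ := exists_smul_linearIsometryEquiv_eq_mul (deriv f z)
  refine ⟨r, e, ?_⟩
  refine (h.hasDerivAt.hasFDerivAt.restrictScalars ℝ).congr_fderiv ?_
  ext1 w
  simpa [mul_comm] using he w

/-- At a point where the conjugate is complex differentiable, the real derivative is a real
multiple of a linear isometry. -/
lemma DifferentiableAt.exists_hasFDerivAt_smul_linearIsometryEquiv_of_conj {f : ℂ → ℂ} {z : ℂ}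
    (h : DifferentiableAt ℂ (fun z => starRingEnd ℂ (f z)) z) :
    ∃ (r : ℝ) (e : ℂ ≃ₗᵢ[ℝ] ℂ), HasFDerivAt f (r • (e : ℂ →L[ℝ] ℂ)) z := by
  obtain ⟨r, e, he⟩ := h.exists_hasFDerivAt_smul_linearIsometryEquiv
  refine ⟨r, e.trans Complex.conjLIE, ?_⟩
  have hc := (Complex.conjCLE : ℂ →L[ℝ] ℂ).hasFDerivAt.comp z he
  refine (hc.congr_fderiv ?_).congr_of_eventuallyEq (.of_forall fun w => ?_)
  · ext1 w
    simp
  · simp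

lemma abs_det_smul_linearIsometryEquiv (r : ℝ) (e : ℂ ≃ₗᵢ[ℝ] ℂ) :
    |(r • (e : ℂ →L[ℝ] ℂ)).det| = r ^ 2 := by
  have he : |LinearMap.det (e.toLinearEquiv : ℂ →ₗ[ℝ] ℂ)| = 1 := by
    rw [← LinearMap.normDet_eq_abs_det]
    exact e.toLinearIsometry.normDet_eq_one
  have : (r • (e : ℂ →L[ℝ] ℂ)).det =
      LinearMap.det (r • (e.toLinearEquiv : ℂ →ₗ[ℝ] ℂ)) := rfl
  rw [this, LinearMap.det_smul, Complex.finrank_real_complex, abs_mul, he, mul_one,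
    abs_of_nonneg (sq_nonneg r)]

/-- Conformal (and anticonformal) invariance of the Dirichlet integral in two
dimensions: if `f` is injective on an open set `U ⊆ ℂ` and holomorphic or
antiholomorphic there, and `u` is `C¹` on an open set containing `f(U)`, then
`∫_{f(U)} ‖∇u‖² = ∫_U ‖∇(u ∘ f)‖²` (as an equality in `[0,∞]`). -/
theorem dirichlet_energy_conformal_invariance
    (U : Set ℂ) (hU : IsOpen U) (f : ℂ → ℂ) (hf : Set.InjOn f U)
    (hol : DifferentiableOn ℂ f U ∨
      DifferentiableOn ℂ (fun z => starRingEnd ℂ (f z)) U)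
    (u : ℂ → ℝ) (V : Set ℂ) (hV : IsOpen V) (hfUV : f '' U ⊆ V)
    (hu : ContDiffOn ℝ 1 u V) :
    ∫⁻ w in f '' U, ENNReal.ofReal (‖fderiv ℝ u w‖ ^ 2) =
      ∫⁻ z in U, ENNReal.ofReal (‖fderiv ℝ (u ∘ f) z‖ ^ 2) := by
  have hconf : ∀ z ∈ U, ∃ (r : ℝ) (e : ℂ ≃ₗᵢ[ℝ] ℂ),
      HasFDerivAt f (r • (e : ℂ →L[ℝ] ℂ)) z := by
    intro z hz
    obtain h | h := hol
    · exact (h.differentiableAt (hU.mem_nhds hz)).exists_hasFDerivAt_smul_linearIsometryEquiv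
    · exact (h.differentiableAt
        (hU.mem_nhds hz)).exists_hasFDerivAt_smul_linearIsometryEquiv_of_conj
  have hf' : ∀ z ∈ U, HasFDerivWithinAt f (fderiv ℝ f z) U z := fun z hz =>
    let ⟨_, _, h⟩ := hconf z hz
    h.differentiableAt.hasFDerivAt.hasFDerivWithinAt
  rw [lintegral_image_eq_lintegral_abs_det_fderiv_mul volume hU.measurableSet hf' hf]
  refine setLIntegral_congr_fun hU.measurableSet fun z hz => ?_
  obtain ⟨r, e, h⟩ := hconf z hz
  have hud : DifferentiableAt ℝ u (f z) :=
    (hu.differentiableOn one_ne_zero).differentiableAt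
      (hV.mem_nhds (hfUV (mem_image_of_mem f hz)))
  have hnorm : ‖fderiv ℝ (u ∘ f) z‖ = |r| * ‖fderiv ℝ u (f z)‖ := by
    rw [(hud.hasFDerivAt.comp z h).fderiv, ContinuousLinearMap.comp_smul, norm_smul,
      Real.norm_eq_abs]
    congr 1
    exact ContinuousLinearMap.opNorm_comp_linearIsometryEquiv _ e
  simp only [h.fderiv, abs_det_smul_linearIsometryEquiv, hnorm]
  rw [← ENNReal.ofReal_mul (sq_nonneg r), mul_pow, sq_abs]
end

section
/- Let n ≥ 1 be an integer and ε > 0. Let P_ε = (0, ε) × (0, ε³) ⊂ ℝ² and define u : ℝ² → ℝ by u(x, y) = sin(2πnx/ε). Then: (i) ∫_{P_ε} ‖∇u‖² dx dy = 2π²n²ε²; (ii) the integral of u² over the two horizontal sides of P_ε equals ε, that is, ∫₀^ε u(x,0)² dx + ∫₀^ε u(x,ε³)² dx = ε; and hence (iii) the Rayleigh quotient (∫_{P_ε} ‖∇u‖² dx dy) / (∫₀^ε u(x,0)² dx + ∫₀^ε u(x,ε³)² dx) equals 2π²n²ε, which tends to 0 as ε → 0⁺ for each fixed n. -/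
open MeasureTheory Real Set Filter

theorem integral_sin_sq_full_periods (n : ℕ) (hn : n ≠ 0) (ε : ℝ) (hε : 0 < ε) :
    ∫ x in Set.Ioo (0:ℝ) ε, Real.sin (2 * π * n * x / ε) ^ 2 = ε / 2 := by
  have hc : 2 * π * n / ε ≠ 0 := by positivity
  have hend : 2 * π * n / ε * ε = ((2 * n : ℕ) : ℝ) * π := by
    push_cast; field_simp
  rw [← integral_Ioc_eq_integral_Ioo, ← intervalIntegral.integral_of_le hε.le]
  have harg : ∀ x : ℝ, 2 * π * n * x / ε = 2 * π * n / ε * x := fun x => by ring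
  simp only [harg]
  rw [intervalIntegral.integral_comp_mul_left (fun y => Real.sin y ^ 2) hc, integral_sin_sq,
    hend, Real.sin_nat_mul_pi]
  simp only [smul_eq_mul, mul_zero, Real.sin_zero]
  push_cast
  field_simp
  ring

theorem integral_cos_sq_full_periods (n : ℕ) (hn : n ≠ 0) (ε : ℝ) (hε : 0 < ε) :
    ∫ x in Set.Ioo (0:ℝ) ε, Real.cos (2 * π * n * x / ε) ^ 2 = ε / 2 := by
  have hint : IntegrableOn (fun x : ℝ => Real.sin (2 * π * n * x / ε) ^ 2) (Set.Ioo 0 ε) :=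
    ((by fun_prop : Continuous fun x : ℝ => Real.sin (2 * π * n * x / ε) ^ 2).integrableOn_Icc
      (a := 0) (b := ε)).mono_set Set.Ioo_subset_Icc_self
  have hone : IntegrableOn (fun _ : ℝ => (1 : ℝ)) (Set.Ioo 0 ε) :=
    integrableOn_const (by simp)
  simp only [Real.cos_sq']
  rw [integral_sub hone hint, integral_sin_sq_full_periods n hn ε hε]
  simp [hε.le]
  ring

theorem norm_fderiv_sin_mul_fst (c : ℝ) (p : ℝ × ℝ) :
    ‖fderiv ℝ (fun q : ℝ × ℝ => Real.sin (c * q.1)) p‖ = |c * Real.cos (c * p.1)| := by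
  have h : HasFDerivAt (fun q : ℝ × ℝ => Real.sin (c * q.1))
      (Real.cos (c * p.1) • c • ContinuousLinearMap.fst ℝ ℝ ℝ) p :=
    (hasFDerivAt_fst.const_mul c).sin
  rw [h.fderiv, norm_smul, norm_smul, ContinuousLinearMap.norm_fst, mul_one, Real.norm_eq_abs,
    Real.norm_eq_abs, abs_mul, mul_comm]

/-- For the thin passage `P_ε = (0,ε) × (0,ε³)` and the test function
`u(x,y) = sin(2πnx/ε)`: the Dirichlet energy of `u` over `P_ε` equals
`2π²n²ε²`, the integral of `u²` over the two horizontal sides equals `ε`, hence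
the Rayleigh quotient equals `2π²n²ε`, which tends to `0` as `ε → 0⁺`. -/
theorem passage_rayleigh_quotient (n : ℕ) (hn : 1 ≤ n) (ε : ℝ) (hε : 0 < ε)
    (u : ℝ × ℝ → ℝ) (hu : ∀ p : ℝ × ℝ, u p = Real.sin (2 * π * n * p.1 / ε)) :
    -- (i) Dirichlet energy over the passage
    (∫ p in (Set.Ioo (0:ℝ) ε) ×ˢ (Set.Ioo (0:ℝ) (ε ^ 3)), ‖fderiv ℝ u p‖ ^ 2 =
      2 * π ^ 2 * n ^ 2 * ε ^ 2) ∧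
    -- (ii) boundary integral over the two horizontal sides
    ((∫ x in Set.Ioo (0:ℝ) ε, u (x, 0) ^ 2) +
      (∫ x in Set.Ioo (0:ℝ) ε, u (x, ε ^ 3) ^ 2) = ε) ∧
    -- (iii) the Rayleigh quotient equals `2π²n²ε` ...
    ((∫ p in (Set.Ioo (0:ℝ) ε) ×ˢ (Set.Ioo (0:ℝ) (ε ^ 3)), ‖fderiv ℝ u p‖ ^ 2) /
        ((∫ x in Set.Ioo (0:ℝ) ε, u (x, 0) ^ 2) +
          (∫ x in Set.Ioo (0:ℝ) ε, u (x, ε ^ 3) ^ 2)) = 2 * π ^ 2 * n ^ 2 * ε) ∧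
    -- ... which tends to `0` as `ε → 0⁺` for fixed `n`
    Tendsto (fun e : ℝ => 2 * π ^ 2 * n ^ 2 * e) (nhdsWithin 0 (Set.Ioi 0))
      (nhds 0) := by
  have hn' : n ≠ 0 := by omega
  have hene : ∫ p in (Set.Ioo (0:ℝ) ε) ×ˢ (Set.Ioo (0:ℝ) (ε ^ 3)), ‖fderiv ℝ u p‖ ^ 2 =
      2 * π ^ 2 * n ^ 2 * ε ^ 2 := by
    have hu' : u = fun q : ℝ × ℝ => Real.sin (2 * π * n / ε * q.1) := by
      funext q
      rw [hu]
      congr 1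
      ring
    have hgrad : ∀ p : ℝ × ℝ, ‖fderiv ℝ u p‖ ^ 2 =
        Real.cos (2 * π * n * p.1 / ε) ^ 2 * (2 * π * n / ε) ^ 2 := by
      intro p
      rw [hu', norm_fderiv_sin_mul_fst, sq_abs, mul_pow, mul_comm]
      congr 3
      ring
    simp only [hgrad]
    rw [Measure.volume_eq_prod, setIntegral_prod_mul
      (fun x : ℝ => Real.cos (2 * π * n * x / ε) ^ 2) (fun _ : ℝ => (2 * π * n / ε) ^ 2),
      integral_cos_sq_full_periods n hn' ε hε, setIntegral_const, Real.volume_real_Ioo_of_le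
      (by positivity), smul_eq_mul]
    field_simp
    ring
  have hbd : (∫ x in Set.Ioo (0:ℝ) ε, u (x, 0) ^ 2) +
      (∫ x in Set.Ioo (0:ℝ) ε, u (x, ε ^ 3) ^ 2) = ε := by
    simp only [hu]
    rw [integral_sin_sq_full_periods n hn' ε hε]
    ring
  refine ⟨hene, hbd, ?_, ?_⟩
  · rw [hene, hbd]
    field_simp
  · have h : Continuous fun e : ℝ => 2 * π ^ 2 * n ^ 2 * e := by fun_prop
    simpa using (h.tendsto 0).mono_left nhdsWithin_le_nhds
end
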